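/- arXiv:2511.01050 — 2 statements merged into one kernel-verified Lean document; each statement's English description precedes it below -/
import Mathlib

section
/- For a nonprincipal ultrafilter U on ω the following are equivalent: (i) U is a p-point and U·U >_T U (i.e. (U,⊇) ≤_T (U·U,⊇) but not (U·U,⊇) ≤_T (U,⊇)); (ii) (ω^ω,≤) is not Tukey reducible to (U,⊇); (iii) U^{<ω} is a P⁺-filter. -/
open Set Filter

/-- `D` is cofinal in the quasi-order `r`: every point is `r`-below some element of `D`. -/
def CofinalIn {α : Type*} (r : α → α → Prop) (D : Set α) : Prop :=
  ∀ p : α, ∃ d ∈ D, r p d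

/-- `(β, rQ)` is Tukey reducible to `(α, rP)`: there is a map `α → β`
sending every cofinal subset of `(α, rP)` to a cofinal subset of `(β, rQ)`. -/
def TukeyLE {β α : Type*} (rQ : β → β → Prop) (rP : α → α → Prop) : Prop :=
  ∃ f : α → β, ∀ D : Set α, CofinalIn rP D → CofinalIn rQ (f '' D)

/-- The quasi-order `(U, ⊇)` on the members of an ultrafilter `U`. -/
def UFOrder (U : Ultrafilter ℕ) : {A : Set ℕ // A ∈ U} → {A : Set ℕ // A ∈ U} → Prop :=
  fun A B => B.1 ⊆ A.1

/-- Everywhere domination order on `ω^ω`. -/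
def domLE (f g : ℕ → ℕ) : Prop := ∀ n, f n ≤ g n

/-- Eventual domination order `≤*` on `ω^ω`. -/
def evDomLE (f g : ℕ → ℕ) : Prop := ∀ᶠ n in atTop, f n ≤ g n

/-- `[A]^{<ω}`: the nonempty finite subsets of `A`. -/
def FinCube (A : Set ℕ) : Set (Finset ℕ) := {s | s.Nonempty ∧ ↑s ⊆ A}

/-- `X ⊆ FIN` is `U^{<ω}`-positive: it consists of nonempty finite sets and
meets `[A]^{<ω}` for every `A ∈ U`. -/
def UPositive (U : Ultrafilter ℕ) (X : Set (Finset ℕ)) : Prop :=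
  (∀ s ∈ X, s.Nonempty) ∧ ∀ A ∈ U, (X ∩ FinCube A).Nonempty

/-- `U^{<ω}` is a P⁺-filter: every ⊆-decreasing sequence of `U^{<ω}`-positive sets
has a `U^{<ω}`-positive pseudo-intersection. -/
def PPlus (U : Ultrafilter ℕ) : Prop :=
  ∀ X : ℕ → Set (Finset ℕ),
    (∀ n, UPositive U (X n)) → (∀ n, X (n + 1) ⊆ X n) →
    ∃ Y : Set (Finset ℕ), UPositive U Y ∧ ∀ n, (Y \ X n).Finite

/-- `U` is a p-point: nonprincipal, and every countable family from `U`
has a pseudo-intersection in `U`. -/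
def IsPPoint (U : Ultrafilter ℕ) : Prop :=
  (∀ a : ℕ, U ≠ pure a) ∧
  ∀ A : ℕ → Set ℕ, (∀ n, A n ∈ U) → ∃ B ∈ U, ∀ n, (B \ A n).Finite

/-- The Fubini product `U · U`, as a family of subsets of `ω × ω`. -/
def Fub (U : Ultrafilter ℕ) : Set (Set (ℕ × ℕ)) :=
  {A | {n : ℕ | {m : ℕ | (n, m) ∈ A} ∈ U} ∈ U}

/-- The quasi-order `(U · U, ⊇)`. -/
def FubOrder (U : Ultrafilter ℕ) :
    {A : Set (ℕ × ℕ) // A ∈ Fub U} → {A : Set (ℕ × ℕ) // A ∈ Fub U} → Prop :=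
  fun A B => B.1 ⊆ A.1

/-- A map preserves cofinal sets iff it is convergent. -/
theorem tukeyLE_iff_convergent {β α : Type*} {rQ : β → β → Prop} {rP : α → α → Prop} :
    TukeyLE rQ rP ↔ ∃ f : α → β, ∀ q, ∃ p, ∀ p', rP p p' → rQ q (f p') := by
  refine exists_congr fun f => ⟨fun hf => ?_, fun hf D hD q => ?_⟩
  · by_contra! hc
    obtain ⟨q, hq⟩ := hc
    obtain ⟨_, ⟨p, hp, rfl⟩, hr⟩ := hf {p' | ¬ rQ q (f p')}
      (fun p => by obtain ⟨p', h1, h2⟩ := hq p; exact ⟨p', h2, h1⟩) q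
    exact hp hr
  · obtain ⟨p, hp⟩ := hf q
    obtain ⟨d, hd, hr⟩ := hD p
    exact ⟨f d, mem_image_of_mem f hd, hp d hr⟩

theorem TukeyLE.trans {γ β α : Type*} {rR : γ → γ → Prop} {rQ : β → β → Prop}
    {rP : α → α → Prop} (h₁ : TukeyLE rR rQ) (h₂ : TukeyLE rQ rP) : TukeyLE rR rP := by
  obtain ⟨f, hf⟩ := h₁
  obtain ⟨g, hg⟩ := h₂
  exact ⟨f ∘ g, fun D hD => image_comp f g D ▸ hf _ (hg D hD)⟩

/-- It suffices to test convergence into `ω^ω` on monotone functions. -/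
theorem tukeyLE_domLE_of_monotone {α : Type*} {rP : α → α → Prop} (f : α → ℕ → ℕ)
    (hf : ∀ g : ℕ → ℕ, Monotone g → ∃ p, ∀ p', rP p p' → domLE g (f p')) :
    TukeyLE domLE rP := by
  refine tukeyLE_iff_convergent.2 ⟨f, fun g => ?_⟩
  obtain ⟨p, hp⟩ := hf (partialSups g) (partialSups g).monotone
  exact ⟨p, fun p' h n => (le_partialSups g n).trans (hp p' h n)⟩

/-- A Tukey reduction of `ω^ω` to `U` can be taken antitone in the set and monotone in the
argument. -/
theorem exists_antitone_of_tukeyLE_domLE {U : Ultrafilter ℕ}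
    (h : TukeyLE domLE (UFOrder U)) :
    ∃ F : Set ℕ → ℕ → ℕ,
      (∀ A B, B ∈ U → B ⊆ A → ∀ m n, m ≤ n → F A m ≤ F B n) ∧
      ∀ g : ℕ → ℕ, ∃ A ∈ U, ∀ n, g n ≤ F A n := by
  obtain ⟨f, hf⟩ := tukeyLE_iff_convergent.1 h
  let S : Set ℕ → ℕ → Set ℕ := fun A n =>
    {k | ∃ B : {B : Set ℕ // B ∈ U}, B.1 ⊆ A ∧ ∃ m, n ≤ m ∧ f B m = k}
  have hS : ∀ B ∈ U, ∀ n, (S B n).Nonempty := fun B hB n =>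
    ⟨f ⟨B, hB⟩ n, ⟨B, hB⟩, Subset.rfl, n, le_rfl, rfl⟩
  refine ⟨fun A n => sInf (S A n), fun A B hB hBA m n hmn => ?_, fun g => ?_⟩
  · obtain ⟨C, hC, l, hl, he⟩ := Nat.sInf_mem (hS B hB n)
    exact Nat.sInf_le ⟨C, hC.trans hBA, l, hmn.trans hl, he⟩
  · obtain ⟨A, hA⟩ := hf (partialSups g)
    refine ⟨A.1, A.2, fun n => ?_⟩
    obtain ⟨C, hC, l, hl, he⟩ := Nat.sInf_mem (hS A.1 A.2 n)
    calc g n ≤ partialSups g l := le_partialSups_of_le g hl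
      _ ≤ f C l := hA C hC l
      _ = _ := he

theorem finite_notMem {U : Ultrafilter ℕ} (hU : ∀ a : ℕ, U ≠ pure a) {S : Set ℕ}
    (hS : S.Finite) : S ∉ U := by
  intro h
  obtain ⟨x, -, hx⟩ := Ultrafilter.eq_pure_of_finite_mem hS h
  exact hU x hx

theorem compl_finite_mem {U : Ultrafilter ℕ} (hU : ∀ a : ℕ, U ≠ pure a) {S : Set ℕ}
    (hS : S.Finite) : Sᶜ ∈ U :=
  Ultrafilter.compl_mem_iff_notMem.2 (finite_notMem hU hS)

/-- An ultrafilter that is not a p-point is Tukey above `ω^ω`. -/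
theorem isPPoint_of_not_tukeyLE {U : Ultrafilter ℕ} (hU : ∀ a : ℕ, U ≠ pure a)
    (h : ¬ TukeyLE domLE (UFOrder U)) : IsPPoint U := by
  by_contra hp
  have hp' : ∃ A : ℕ → Set ℕ, (∀ n, A n ∈ U) ∧ ∀ B ∈ U, ∃ n, ¬ (B \ A n).Finite := by
    by_contra! hc
    exact hp ⟨hU, hc⟩
  obtain ⟨A, hA, hAB⟩ := hp'
  let C : ℕ → Set ℕ := fun n => ⋂ i ∈ Finset.range (n + 1), A i
  have hC : ∀ n, C n ∈ U := fun n =>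
    (Filter.biInter_finset_mem (f := (U : Filter ℕ)) _).2 fun i _ => hA i
  apply h
  refine tukeyLE_domLE_of_monotone (fun B n => sInf (B.1 ∩ C n)) fun g hg => ?_
  have hE : {x | ∃ n, x ∈ C n ∧ x ≤ g n}ᶜ ∈ U := by
    refine Ultrafilter.compl_mem_iff_notMem.2 fun hmem => ?_
    obtain ⟨n, hn⟩ := hAB _ hmem
    refine hn ((Set.finite_Iic (g n)).subset ?_)
    rintro x ⟨⟨m, hxm, hxg⟩, hxA⟩
    have hmn : m < n := by
      by_contra! hle
      exact hxA (mem_iInter₂.1 hxm n (by simp; omega))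
    exact hxg.trans (hg hmn.le)
  refine ⟨⟨_, hE⟩, fun B hB n => ?_⟩
  have hne : (B.1 ∩ C n).Nonempty := Ultrafilter.nonempty_of_mem (inter_mem B.2 (hC n))
  obtain ⟨hxB, hxC⟩ := Nat.sInf_mem hne
  by_contra! hlt
  exact hB hxB ⟨n, hxC, hlt.le⟩

theorem tukeyLE_ufOrder_fubOrder (U : Ultrafilter ℕ) : TukeyLE (UFOrder U) (FubOrder U) := by
  refine tukeyLE_iff_convergent.2 ⟨fun X => ⟨_, X.2⟩, fun A => ?_⟩
  have hA : {p : ℕ × ℕ | p.1 ∈ A.1} ∈ Fub U := by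
    refine mem_of_superset A.2 fun n hn => ?_
    rw [mem_ofPred_eq]
    exact mem_of_superset univ_mem fun _ _ => hn
  refine ⟨⟨_, hA⟩, fun X hX n hn => ?_⟩
  obtain ⟨m, hm⟩ := Ultrafilter.nonempty_of_mem hn
  exact hX hm

theorem tukeyLE_domLE_fubOrder {U : Ultrafilter ℕ} (hU : ∀ a : ℕ, U ≠ pure a) :
    TukeyLE domLE (FubOrder U) := by
  refine tukeyLE_domLE_of_monotone (fun X n => sInf {k | ∃ m, n ≤ m ∧ (m, k) ∈ X.1})
    fun g hg => ?_
  have hA : {p : ℕ × ℕ | g p.1 ≤ p.2} ∈ Fub U := by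
    refine mem_of_superset univ_mem fun n _ => ?_
    refine mem_of_superset (compl_finite_mem hU (Set.finite_Iio (g n))) fun m hm => ?_
    simpa using hm
  refine ⟨⟨_, hA⟩, fun X hX n => ?_⟩
  have hne : {k | ∃ m, n ≤ m ∧ (m, k) ∈ X.1}.Nonempty := by
    obtain ⟨m, hm, hnm⟩ := Ultrafilter.nonempty_of_mem
      (inter_mem X.2 (compl_finite_mem hU (Set.finite_Iio n)))
    obtain ⟨k, hk⟩ := Ultrafilter.nonempty_of_mem hm
    exact ⟨k, m, by simpa using hnm, hk⟩
  obtain ⟨m, hnm, hm⟩ := Nat.sInf_mem hne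
  exact (hg hnm).trans (hX hm)

/-- A p-point that is Tukey above `ω^ω` is Tukey above its Fubini square. -/
theorem tukeyLE_fubOrder_ufOrder {U : Ultrafilter ℕ} (hp : IsPPoint U)
    (h : TukeyLE domLE (UFOrder U)) : TukeyLE (FubOrder U) (UFOrder U) := by
  obtain ⟨F, hF⟩ := tukeyLE_iff_convergent.1 h
  have hH : ∀ B : {B : Set ℕ // B ∈ U},
      {p : ℕ × ℕ | p.1 ∈ B.1 ∧ p.2 ∈ B.1 ∧ F B p.1 < p.2} ∈ Fub U := by
    refine fun B => mem_of_superset B.2 fun n hn => ?_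
    refine mem_of_superset (inter_mem B.2 (compl_finite_mem hp.1 (Set.finite_Iic (F B n))))
      fun m hm => ⟨hn, hm.1, by simpa using hm.2⟩
  refine tukeyLE_iff_convergent.2 ⟨fun B => ⟨_, hH B⟩, fun X => ?_⟩
  let C : Set ℕ := {n | {m | (n, m) ∈ X.1} ∈ U}
  obtain ⟨A, hA, hAfin⟩ := hp.2 (fun n => {m | n ∈ C → (n, m) ∈ X.1}) fun n => by
    by_cases hn : n ∈ C
    · exact mem_of_superset hn fun m hm _ => hm
    · exact mem_of_superset univ_mem fun m _ hn' => absurd hn' hn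
  choose g hg using fun n => (hAfin n).bddAbove
  obtain ⟨A', hA'⟩ := hF g
  refine ⟨⟨A ∩ C ∩ A'.1, inter_mem (inter_mem hA X.2) A'.2⟩, ?_⟩
  rintro B hB ⟨n, m⟩ ⟨hn, hm, hlt⟩
  by_contra hX
  have h1 : m ≤ g n := hg n ⟨(hB hm).1.1, fun hc => hX (hc (hB hn).1.2)⟩
  have h2 : g n ≤ F B n := hA' B (fun x hx => (hB hx).2) n
  exact absurd hlt (not_lt.2 (h1.trans h2))

theorem pPlus_of_not_tukeyLE {U : Ultrafilter ℕ} (h : ¬ TukeyLE domLE (UFOrder U)) :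
    PPlus U := by
  intro X hX hdec
  by_contra! hc
  apply h
  refine tukeyLE_domLE_of_monotone
    (fun A n => sInf (Encodable.encode '' (X n ∩ FinCube A.1))) fun g hg => ?_
  have hanti : Antitone X := antitone_nat_of_succ_le hdec
  let Y : Set (Finset ℕ) := {s | ∃ n, s ∈ X n ∧ Encodable.encode s ≤ g n}
  have hY : ∀ n, (Y \ X n).Finite := by
    refine fun n => ((Set.finite_Iic (g n)).preimage
      (Encodable.encode_injective (α := Finset ℕ)).injOn).subset ?_
    rintro s ⟨⟨m, hsm, hsg⟩, hsn⟩
    have hmn : m ≤ n := by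
      by_contra! hlt
      exact hsn (hanti hlt.le hsm)
    exact hsg.trans (hg hmn)
  have hnot : ¬ UPositive U Y := fun hpos => (hc Y hpos).elim fun n hn => hn (hY n)
  have hex : ∃ A ∈ U, ¬ (Y ∩ FinCube A).Nonempty := by
    by_contra! hall
    exact hnot ⟨fun s ⟨n, hs, _⟩ => (hX n).1 s hs, hall⟩
  obtain ⟨A, hA, hAY⟩ := hex
  refine ⟨⟨A, hA⟩, fun B hB n => ?_⟩
  obtain ⟨s, ⟨hsX, hsB⟩, hs⟩ := Nat.sInf_mem (((hX n).2 B.1 B.2).image Encodable.encode)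
  by_contra! hlt
  exact hAY ⟨s, ⟨n, hsX, hs ▸ hlt.le⟩, hsB.1, hsB.2.trans hB⟩

/-- Removing finitely many sets preserves positivity. -/
theorem UPositive.inter_of_finite_diff {U : Ultrafilter ℕ} (hU : ∀ a : ℕ, U ≠ pure a)
    {Y X : Set (Finset ℕ)} (hY : UPositive U Y) (hfin : (Y \ X).Finite) :
    UPositive U (Y ∩ X) := by
  refine ⟨fun s hs => hY.1 s hs.1, fun A hA => ?_⟩
  have hS : (⋃ s ∈ Y \ X, (s : Set ℕ)).Finite := hfin.biUnion fun s _ => s.finite_toSet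
  obtain ⟨s, hsY, hne, hs⟩ := hY.2 _ (inter_mem hA (compl_finite_mem hU hS))
  refine ⟨s, ⟨hsY, ?_⟩, hne, fun x hx => (hs hx).1⟩
  by_contra hsX
  obtain ⟨x, hx⟩ := hne
  exact (hs hx).2 (mem_iUnion₂.2 ⟨s, ⟨hsY, hsX⟩, hx⟩)

theorem PPlus.isPPoint {U : Ultrafilter ℕ} (hU : ∀ a : ℕ, U ≠ pure a) (h : PPlus U) :
    IsPPoint U := by
  refine ⟨hU, fun A hA => ?_⟩
  let C : ℕ → Set ℕ := fun n => ⋂ i ∈ Finset.range (n + 1), A i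
  have hC : ∀ n, C n ∈ U := fun n =>
    (Filter.biInter_finset_mem (f := (U : Filter ℕ)) _).2 fun i _ => hA i
  obtain ⟨Y, hY, hYfin⟩ := h (fun n => (fun k => ({k} : Finset ℕ)) '' C n)
    (fun n => ⟨by rintro _ ⟨k, -, rfl⟩; simp, fun B hB => by
      obtain ⟨k, hkB, hkC⟩ := Ultrafilter.nonempty_of_mem (inter_mem hB (hC n))
      exact ⟨{k}, ⟨k, hkC, rfl⟩, by simp, by simpa using hkB⟩⟩)
    (fun n => image_mono (biInter_subset_biInter_left (by
      intro i hi; simp at hi ⊢; omega)))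
  have hY' := hY.inter_of_finite_diff hU (hYfin 0)
  refine ⟨{k | ({k} : Finset ℕ) ∈ Y}, ?_, fun n => ?_⟩
  · by_contra hn
    obtain ⟨s, ⟨hsY, k, -, rfl⟩, -, hs⟩ := hY'.2 _ (Ultrafilter.compl_mem_iff_notMem.2 hn)
    exact hs (by simp : k ∈ ((({k} : Finset ℕ)) : Set ℕ)) hsY
  · refine ((hYfin n).preimage (Finset.singleton_injective (α := ℕ)).injOn).subset ?_
    rintro k ⟨hkY, hkA⟩
    refine ⟨hkY, ?_⟩
    rintro ⟨j, hj, hjk⟩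
    obtain rfl : j = k := Finset.singleton_injective hjk
    exact hkA (mem_iInter₂.1 hj n (by simp))

/-- Every ultrafilter on `ω` has a member with arbitrarily late gaps of prescribed length. -/
theorem exists_mem_gaps (U : Ultrafilter ℕ) (h : ℕ → ℕ) (hh : ∀ m, m < h m) :
    ∃ E ∈ U, ∀ N, ∃ m, N ≤ m ∧ ∀ x ∈ E, m ≤ x → h m ≤ x := by
  let a : ℕ → ℕ := fun i => h^[i] 0
  have ha : ∀ i, a (i + 1) = h (a i) := fun i => Function.iterate_succ_apply' h i 0
  have hmono : StrictMono a := strictMono_nat_of_lt_succ fun i => ha i ▸ hh (a i)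
  let E : Set ℕ := {x | ∃ i, a (2 * i) ≤ x ∧ x < a (2 * i + 1)}
  rcases Ultrafilter.mem_or_compl_mem U E with hE | hE
  · refine ⟨E, hE, fun N => ⟨a (2 * N + 1), ?_, ?_⟩⟩
    · have := hmono.le_apply (x := 2 * N + 1)
      omega
    · rintro x ⟨i, h1, h2⟩ hx
      have hlt := hmono.lt_iff_lt.1 (hx.trans_lt h2)
      exact ha _ ▸ (hmono.monotone (by omega : 2 * N + 1 + 1 ≤ 2 * i)).trans h1
  · refine ⟨Eᶜ, hE, fun N => ⟨a (2 * N), ?_, ?_⟩⟩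
    · have := hmono.le_apply (x := 2 * N)
      omega
    · intro x hx hle
      by_contra! hlt
      exact hx ⟨N, hle, (ha (2 * N)).symm ▸ hlt⟩

/-- On a p-point, an antitone map into `ω` is locally bounded by finite information. -/
theorem IsPPoint.exists_finset_bound {U : Ultrafilter ℕ} (hp : IsPPoint U) (F : Set ℕ → ℕ)
    (hF : ∀ A B, B ∈ U → B ⊆ A → F A ≤ F B) {A : Set ℕ} (hA : A ∈ U) :
    ∃ s : Finset ℕ, ↑s ⊆ A ∧ ∃ k, ∀ B ∈ U, F (↑s ∪ B) ≤ k := by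
  by_contra! hc
  have hc' : ∀ (s : Finset ℕ) (k : ℕ), ∃ B ∈ U, ↑s ⊆ A → k < F (↑s ∪ B) := by
    intro s k
    by_cases hs : ↑s ⊆ A
    · obtain ⟨B, hB, hk⟩ := hc s hs k
      exact ⟨B, hB, fun _ => hk⟩
    · exact ⟨univ, univ_mem, fun h => absurd h hs⟩
  choose D hD hDF using hc'
  obtain ⟨B, hB, hBfin⟩ := hp.2 (fun i => ⋂ s ∈ (Finset.range i).powerset, D s i) fun i =>
    (Filter.biInter_finset_mem (f := (U : Filter ℕ)) _).2 fun s _ => hD s i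
  choose b hb using fun n => (hBfin n).bddAbove
  obtain ⟨E, hE, hgap⟩ := exists_mem_gaps U (fun m => m + b m + 1) fun m => by omega
  have hB' : A ∩ B ∩ E ∈ U := inter_mem (inter_mem hA hB) hE
  obtain ⟨m, hm, hmE⟩ := hgap (F (A ∩ B ∩ E))
  classical
  let s : Finset ℕ := (Finset.range m).filter (· ∈ A ∩ B ∩ E)
  have hsA : ↑s ⊆ A := fun x hx => (Finset.mem_filter.1 hx).2.1.1
  have hsub : A ∩ B ∩ E ⊆ ↑s ∪ D s m := by
    intro x hx
    by_cases hxm : x < m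
    · exact Or.inl (Finset.mem_filter.2 ⟨Finset.mem_range.2 hxm, hx⟩)
    · right
      by_contra hxD
      have h1 : x ≤ b m := hb m ⟨hx.1.2, fun hmem => hxD
        (mem_iInter₂.1 hmem s (Finset.mem_powerset.2 (Finset.filter_subset _ _)))⟩
      have h2 := hmE x hx.2 (not_lt.1 hxm)
      omega
  have h3 := hF _ _ hB' hsub
  have h4 := hDF s m hsA
  omega

theorem PPlus.not_tukeyLE {U : Ultrafilter ℕ} (hU : ∀ a : ℕ, U ≠ pure a) (h : PPlus U) :
    ¬ TukeyLE domLE (UFOrder U) := by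
  intro hT
  have hp := h.isPPoint hU
  obtain ⟨F, hanti, hconv⟩ := exists_antitone_of_tukeyLE_domLE hT
  let X : ℕ → Set (Finset ℕ) := fun n =>
    {s | s.Nonempty ∧ ∃ k, ∀ B ∈ U, F (↑s ∪ B) n ≤ k}
  have hX : ∀ n, UPositive U (X n) := by
    refine fun n => ⟨fun s hs => hs.1, fun A hA => ?_⟩
    obtain ⟨s, hsA, k, hk⟩ := hp.exists_finset_bound (fun A => F A n)
      (fun A B hB hBA => hanti A B hB hBA n n le_rfl) hA
    have hne : s.Nonempty := by
      rw [Finset.nonempty_iff_ne_empty]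
      rintro rfl
      obtain ⟨B, hB, hBk⟩ := hconv fun _ => k + 1
      have h1 := hk B hB
      rw [Finset.coe_empty, empty_union] at h1
      have h2 := hBk n
      omega
    exact ⟨s, ⟨hne, k, hk⟩, hne, hsA⟩
  have hdec : ∀ n, X (n + 1) ⊆ X n := by
    rintro n s ⟨hne, k, hk⟩
    exact ⟨hne, k, fun B hB => (hanti _ _ (mem_of_superset hB subset_union_right) Subset.rfl
      n (n + 1) n.le_succ).trans (hk B hB)⟩
  obtain ⟨Y, hY, hYfin⟩ := h X hX hdec
  have hbd : ∀ (n : ℕ) (s : Finset ℕ), ∃ k, s ∈ X n → ∀ B ∈ U, F (↑s ∪ B) n ≤ k := by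
    intro n s
    by_cases hs : s ∈ X n
    · obtain ⟨-, k, hk⟩ := hs
      exact ⟨k, fun _ => hk⟩
    · exact ⟨0, fun h => absurd h hs⟩
  choose k hk using hbd
  let E : ℕ → Set (Finset ℕ) := fun n =>
    {s | s ∈ Y ∧ (Encodable.encode s ≤ n ∨ s ∉ X (n + 1))}
  have hE : ∀ n, (E n).Finite := by
    refine fun n => (((Set.finite_Iic n).preimage
      (Encodable.encode_injective (α := Finset ℕ)).injOn).union (hYfin (n + 1))).subset ?_
    rintro s ⟨hsY, hs | hs⟩
    · exact Or.inl hs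
    · exact Or.inr ⟨hsY, hs⟩
  choose g hg using fun n => ((hE n).image (k n)).bddAbove
  obtain ⟨A, hA, hAg⟩ := hconv fun n => g n + 1
  obtain ⟨s, ⟨hsY, hs0⟩, -, hsA⟩ := (hY.inter_of_finite_diff hU (hYfin 0)).2 A hA
  have hnot : ∀ n, s ∈ X n → s ∉ E n := by
    intro n hsn hsE
    have h1 : k n s ≤ g n := hg n (mem_image_of_mem _ hsE)
    have h2 := hk n s hsn A hA
    rw [union_eq_self_of_subset_left hsA] at h2
    have h3 := hAg n
    omega
  have hall : ∀ n, s ∈ X n := by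
    intro n
    induction n with
    | zero => exact hs0
    | succ n ih =>
      by_contra hn
      exact hnot n ih ⟨hsY, Or.inr hn⟩
  exact hnot _ (hall _) ⟨hsY, Or.inl le_rfl⟩

/-- Theorem: for a nonprincipal ultrafilter `U` on `ω`, the following are equivalent:
(i) `U` is a p-point and `U·U >_T U`;
(ii) `(ω^ω, ≤)` is not Tukey reducible to `(U, ⊇)`;
(iii) `U^{<ω}` is a P⁺-filter. -/
theorem stmt_1 (U : Ultrafilter ℕ) (hU : ∀ a : ℕ, U ≠ pure a) :
    ((IsPPoint U ∧ TukeyLE (UFOrder U) (FubOrder U) ∧ ¬ TukeyLE (FubOrder U) (UFOrder U))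
        ↔ ¬ TukeyLE domLE (UFOrder U)) ∧
    (¬ TukeyLE domLE (UFOrder U) ↔ PPlus U) := by
  refine ⟨⟨fun ⟨hp, _, hn⟩ h => hn (tukeyLE_fubOrder_ufOrder hp h), fun h => ?_⟩,
    pPlus_of_not_tukeyLE, PPlus.not_tukeyLE hU⟩
  exact ⟨isPPoint_of_not_tukeyLE hU h, tukeyLE_ufOrder_fubOrder U,
    fun hF => h ((tukeyLE_domLE_fubOrder hU).trans hF)⟩
end

section
/- Let μ < λ be uncountable cardinals, let U be a nonprincipal ultrafilter on ω with character χ(U) = μ, and let V be a nonprincipal ultrafilter on ω that is a P_λ-point. Then both U^{<ω} and V^{<ω} are P⁺-filters (i.e. U and V are both Canjar). -/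
open Set Filter

/-- The dominating number `𝔡`: least cardinality of a family `D ⊆ ω^ω` such that
every `g` is everywhere dominated by some member of `D`. -/
noncomputable def dominatingNumber : Cardinal :=
  sInf {c : Cardinal | ∃ D : Set (ℕ → ℕ), Cardinal.mk ↥D = c ∧
    ∀ g : ℕ → ℕ, ∃ f ∈ D, domLE g f}

/-- The character `χ(U)`: least cardinality of a base of `U`. -/
noncomputable def charUF (U : Ultrafilter ℕ) : Cardinal :=
  sInf {c : Cardinal | ∃ B : Set (Set ℕ), (∀ A ∈ B, A ∈ U) ∧ Cardinal.mk ↥B = c ∧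
    ∀ A ∈ U, ∃ B' ∈ B, B' ⊆ A}

/-- The bounding number `𝔟`: least cardinality of a family `F ⊆ ω^ω` unbounded
in `(ω^ω, ≤*)`. -/
noncomputable def boundingNumber : Cardinal :=
  sInf {c : Cardinal | ∃ F : Set (ℕ → ℕ), Cardinal.mk ↥F = c ∧
    ¬ ∃ g : ℕ → ℕ, ∀ f ∈ F, evDomLE f g}

/-- The least element of `A` that is at least `n`. -/
noncomputable def nextElem (A : Set ℕ) (n : ℕ) : ℕ := sInf {x ∈ A | n ≤ x}

theorem nextElem_spec {A : Set ℕ} (hA : A.Infinite) (n : ℕ) :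
    nextElem A n ∈ A ∧ n ≤ nextElem A n := by
  obtain ⟨x, hx, hnx⟩ := hA.exists_gt n
  exact Nat.sInf_mem (s := {x ∈ A | n ≤ x}) ⟨x, hx, hnx.le⟩

/-- Every ultrafilter on `ω` has a member with infinitely many gaps of the form `[n, h n)`. -/
theorem Ultrafilter.exists_mem_frequently_gap (W : Ultrafilter ℕ) (h : ℕ → ℕ) :
    ∃ A ∈ W, ∀ k, ∃ n ≥ k, ∀ x ∈ A, n ≤ x → h n ≤ x := by
  obtain ⟨a, ha⟩ : ∃ a : ℕ → ℕ, ∀ i, a (i + 1) = max (h (a i)) (a i + 1) :=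
    ⟨fun i => Nat.rec 0 (fun _ m => max (h m) (m + 1)) i, fun _ => rfl⟩
  have hmono : StrictMono a := strictMono_nat_of_lt_succ fun i => by rw [ha]; omega
  let E : Set ℕ := {x | ∃ i, Even i ∧ a i ≤ x ∧ x < a (i + 1)}
  have index_unique : ∀ i j, ∀ x, a i ≤ x → x < a (i + 1) → a j ≤ x → x < a (j + 1) → i = j := by
    intro i j x h1 h2 h3 h4
    have := hmono.lt_iff_lt.1 (h1.trans_lt h4)
    have := hmono.lt_iff_lt.1 (h3.trans_lt h2)
    omega
  have gap : ∀ i x, ¬ x < a (i + 1) → h (a i) ≤ x := by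
    intro i x h2
    rw [ha] at h2
    omega
  rcases W.mem_or_compl_mem E with hE | hE
  · refine ⟨E, hE, fun k => ⟨a (2 * k + 1), ?_, ?_⟩⟩
    · have := hmono.le_apply (x := 2 * k + 1)
      omega
    · rintro x ⟨i, hi, h1, h2⟩ hx
      refine gap _ _ fun h3 => ?_
      have := index_unique _ _ x h1 h2 hx h3
      grind
  · refine ⟨Eᶜ, hE, fun k => ⟨a (2 * k), ?_, ?_⟩⟩
    · have := hmono.le_apply (x := 2 * k)
      omega
    · intro x hx hax
      exact gap _ _ fun h3 => hx ⟨2 * k, by simp, hax, h3⟩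

theorem Ultrafilter.infinite_of_mem {U : Ultrafilter ℕ} (hU : ∀ a : ℕ, U ≠ pure a)
    {A : Set ℕ} (hA : A ∈ U) : A.Infinite := by
  intro hfin
  obtain ⟨a, -, ha⟩ := Ultrafilter.eq_pure_of_finite_mem hfin hA
  exact hU a ha

/-- A nonprincipal `P_λ`-point shows that fewer than `λ` functions are not dominating. -/
theorem exists_not_dominated_of_pseudoIntersection {lam : Cardinal} {V : Ultrafilter ℕ}
    (hV : ∀ a : ℕ, V ≠ pure a)
    (hP : ∀ 𝒳 : Set (Set ℕ), (∀ A ∈ 𝒳, A ∈ V) → Cardinal.mk ↥𝒳 < lam →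
      ∃ A ∈ V, ∀ X ∈ 𝒳, (A \ X).Finite)
    {ι : Type} (hι : Cardinal.mk ι < lam) (f : ι → ℕ → ℕ) :
    ∃ g : ℕ → ℕ, ∀ i, ∃ n, f i n ≤ g n := by
  choose A hA hgap using fun i => V.exists_mem_frequently_gap (f i)
  obtain ⟨P, hPV, hP⟩ := hP (range A) (by rintro _ ⟨i, rfl⟩; exact hA i)
    (Cardinal.mk_range_le.trans_lt hι)
  refine ⟨nextElem P, fun i => ?_⟩
  obtain ⟨k, hk⟩ := (hP (A i) ⟨i, rfl⟩).bddAbove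
  obtain ⟨n, hn, hgap⟩ := hgap i (k + 1)
  obtain ⟨hmem, hle⟩ := nextElem_spec (Ultrafilter.infinite_of_mem hV hPV) n
  refine ⟨n, hgap _ ?_ hle⟩
  by_contra hc
  have := hk ⟨hmem, hc⟩
  omega

/-- The union over `n` of the members of `X n` contained in `[0, g n]`. -/
def boundedDiagonal (X : ℕ → Set (Finset ℕ)) (g : ℕ → ℕ) : Set (Finset ℕ) :=
  {s | ∃ n, s ∈ X n ∧ ∀ x ∈ s, x ≤ g n}

theorem boundedDiagonal_diff_finite {X : ℕ → Set (Finset ℕ)} (hX : ∀ n, X (n + 1) ⊆ X n)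
    (g : ℕ → ℕ) (m : ℕ) : (boundedDiagonal X g \ X m).Finite := by
  refine ((finite_Iio m).biUnion fun n _ =>
    (Finset.finite_toSet (Finset.range (g n + 1)).powerset)).subset ?_
  rintro s ⟨⟨n, hs, hb⟩, hsm⟩
  have hnm : n < m := by
    by_contra hc
    exact hsm (antitone_nat_of_succ_le hX (not_lt.1 hc) hs)
  refine mem_biUnion (mem_Iio.2 hnm) ?_
  simp only [Finset.mem_coe, Finset.mem_powerset]
  intro x hx
  have := hb x hx
  simp only [Finset.mem_range]
  omega

/-- To verify the P⁺ property it suffices to make some bounded diagonal positive. -/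
theorem PPlus.of_boundedDiagonal {U : Ultrafilter ℕ}
    (h : ∀ X : ℕ → Set (Finset ℕ), (∀ n, UPositive U (X n)) →
      ∃ g, ∀ A ∈ U, (boundedDiagonal X g ∩ FinCube A).Nonempty) : PPlus U := by
  intro X hpos hX
  obtain ⟨g, hg⟩ := h X hpos
  refine ⟨boundedDiagonal X g, ⟨?_, hg⟩, boundedDiagonal_diff_finite hX g⟩
  rintro s ⟨n, hs, -⟩
  exact (hpos n).1 s hs

theorem exists_base_of_charUF (U : Ultrafilter ℕ) :
    ∃ B : Set (Set ℕ), (∀ A ∈ B, A ∈ U) ∧ Cardinal.mk ↥B = charUF U ∧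
      ∀ A ∈ U, ∃ B' ∈ B, B' ⊆ A :=
  csInf_mem (s := {c : Cardinal | ∃ B : Set (Set ℕ), (∀ A ∈ B, A ∈ U) ∧ Cardinal.mk ↥B = c ∧
    ∀ A ∈ U, ∃ B' ∈ B, B' ⊆ A})
    ⟨_, {A | A ∈ U}, fun _ h => h, rfl, fun A hA => ⟨A, hA, Subset.rfl⟩⟩

/-- Theorem: if `μ < λ` are uncountable cardinals, `U` is a nonprincipal ultrafilter
with `χ(U) = μ`, and `V` is a nonprincipal `P_λ`-point, then `U^{<ω}` and `V^{<ω}`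
are both P⁺-filters (i.e. `U` and `V` are both Canjar). -/
theorem stmt_12 (μ lam : Cardinal) (hμ : Cardinal.aleph0 < μ) (hlam : Cardinal.aleph0 < lam)
    (hlt : μ < lam)
    (U V : Ultrafilter ℕ) (hU : ∀ a : ℕ, U ≠ pure a) (hV : ∀ a : ℕ, V ≠ pure a)
    (hchar : charUF U = μ)
    (hPpoint : ∀ 𝒳 : Set (Set ℕ), (∀ A ∈ 𝒳, A ∈ V) → Cardinal.mk ↥𝒳 < lam →
      ∃ A ∈ V, ∀ X ∈ 𝒳, (A \ X).Finite) :
    PPlus U ∧ PPlus V := by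
  obtain ⟨B, hBU, hBcard, hB⟩ := exists_base_of_charUF U
  have hBlt : Cardinal.mk ↥B < lam := by rwa [hBcard, hchar]
  refine ⟨PPlus.of_boundedDiagonal fun X hpos => ?_, PPlus.of_boundedDiagonal fun X hpos => ?_⟩
  · choose s hsX hs using fun (b : B) n => (hpos n).2 b (hBU b b.2)
    obtain ⟨g, hg⟩ := exists_not_dominated_of_pseudoIntersection hV hPpoint hBlt
      (fun b n => (s b n).sup id)
    refine ⟨g, fun A hA => ?_⟩
    obtain ⟨b, hb, hbA⟩ := hB A hA
    obtain ⟨n, hn⟩ := hg ⟨b, hb⟩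
    exact ⟨s ⟨b, hb⟩ n, ⟨n, hsX _ _, fun x hx => (Finset.le_sup (f := id) hx).trans hn⟩,
      (hs _ _).1, (hs _ _).2.trans hbA⟩
  · by_contra! hc
    choose A hA hempty using fun b : B => hc (nextElem b)
    obtain ⟨P, hPV, hP⟩ := hPpoint (range A) (by rintro _ ⟨i, rfl⟩; exact hA i)
      (Cardinal.mk_range_le.trans_lt hBlt)
    have htail : ∀ k, P \ Iio k ∈ V := fun k => by
      refine V.sdiff_mem_iff.2 ⟨hPV, fun hk => ?_⟩
      exact Ultrafilter.infinite_of_mem hV hk (finite_Iio k)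
    choose s hsX hs using fun k n => (hpos n).2 _ (htail k)
    obtain ⟨C, hC, hgap⟩ := U.exists_mem_frequently_gap
      (fun n => (Finset.range (n + 1)).sup fun k => (s k n).sup id)
    obtain ⟨b, hb, hbC⟩ := hB C hC
    obtain ⟨k, hk⟩ := (hP (A ⟨b, hb⟩) ⟨_, rfl⟩).bddAbove
    obtain ⟨n, hn, hgap⟩ := hgap (k + 1)
    obtain ⟨hmem, hle⟩ := nextElem_spec (Ultrafilter.infinite_of_mem hU (hBU b hb)) n
    have hbound := hgap _ (hbC hmem) hle
    have hin : s (k + 1) n ∈ boundedDiagonal X (nextElem b) ∩ FinCube (A ⟨b, hb⟩) := by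
      refine ⟨⟨n, hsX _ _, fun x hx => ?_⟩, (hs _ _).1, fun x hx => ?_⟩
      · refine ((Finset.le_sup (f := id) hx).trans ?_).trans hbound
        exact Finset.le_sup (f := fun k => (s k n).sup id) (Finset.mem_range.2 (by omega))
      · obtain ⟨hxP, hxk⟩ := (hs _ _).2 hx
        by_contra hxA
        have := hk ⟨hxP, hxA⟩
        simp only [mem_Iio] at hxk
        omega
    exact (hempty ⟨b, hb⟩).subset hin
end
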